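/- Dual formulation of WOP: for all μ, ν ∈ M(ℝ^d) with m_μ > 0 and m_ν > 0, WOP²(μ,ν) = sup { ∫φ dμ + ∫ψ dν }, where the supremum is over all pairs of bounded continuous functions (φ, ψ) on ℝ^d satisfying m_μ·φ(x) + m_ν·ψ(y) ≤ (m_μ−m_ν)² + |T_{m_μ}(x) − T_{m_ν}(y)|² for μ⊗ν-almost every (x,y). -/

import Mathlib

open MeasureTheory

noncomputable section

abbrev Euc (d : ℕ) := EuclideanSpace ℝ (Fin d)

variable {d : ℕ}

/-- Total mass of a measure. -/
def mass (μ : Measure (Euc d)) : ℝ := (μ Set.univ).toReal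

/-- Second moment centered at `x₀`. -/
def sndMoment (x₀ : Euc d) (μ : Measure (Euc d)) : ℝ := ∫ x, ‖x - x₀‖ ^ 2 ∂μ

/-- `μ ∈ M(ℝ^d)`: finite positive measure with finite second moment. -/
def MemM (μ : Measure (Euc d)) : Prop :=
  IsFiniteMeasure μ ∧ Integrable (fun x => ‖x‖ ^ 2) μ

/-- `μ ∈ P₂(ℝ^d)`: probability measure with finite second moment. -/
def MemP2 (μ : Measure (Euc d)) : Prop :=
  IsProbabilityMeasure μ ∧ Integrable (fun x => ‖x‖ ^ 2) μ

/-- Squared 2-Wasserstein distance, as an infimum over couplings. -/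
def W2sq (μ ν : Measure (Euc d)) : ℝ :=
  sInf { r : ℝ | ∃ π : Measure (Euc d × Euc d),
    π.map Prod.fst = μ ∧ π.map Prod.snd = ν ∧ r = ∫ p, ‖p.1 - p.2‖ ^ 2 ∂π }

/-- 2-Wasserstein distance. -/
def W2 (μ ν : Measure (Euc d)) : ℝ := Real.sqrt (W2sq μ ν)

/-- The dilation `T_a(x) = a (x - x₀) + x₀`. -/
def dil (x₀ : Euc d) (a : ℝ) (x : Euc d) : Euc d := a • (x - x₀) + x₀

/-- Normalization `μ̄` of `μ`, with the convention `μ̄ = δ_{x₀}` for the null measure. -/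
def nm (x₀ : Euc d) (μ : Measure (Euc d)) : Measure (Euc d) :=
  if μ Set.univ = 0 then Measure.dirac x₀ else (μ Set.univ)⁻¹ • μ

/-- Squared WOP metric with reference point `x₀`. -/
def WOP2 (x₀ : Euc d) (μ ν : Measure (Euc d)) : ℝ :=
  (mass μ - mass ν) ^ 2 +
    W2sq ((nm x₀ μ).map (dil x₀ (mass μ))) ((nm x₀ ν).map (dil x₀ (mass ν)))

/-- The WOP metric with reference point `x₀`. -/
def WOP (x₀ : Euc d) (μ ν : Measure (Euc d)) : ℝ := Real.sqrt (WOP2 x₀ μ ν)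

open Filter Topology CompactlySupported
open scoped BoundedContinuousFunction

section Cutoff

/-- A proper metric space carries a sequence of compactly supported cutoffs converging to `1`. -/
lemma exists_cutoff_seq (X : Type*) [PseudoMetricSpace X] [ProperSpace X] :
    ∃ a : ℕ → X → ℝ, (∀ n, Continuous (a n)) ∧ (∀ n, HasCompactSupport (a n)) ∧
      (∀ n x, 0 ≤ a n x) ∧ (∀ n x, a n x ≤ 1) ∧
      ∀ x, Tendsto (fun n => a n x) atTop (𝓝 1) := by
  rcases isEmpty_or_nonempty X with hX | ⟨⟨z⟩⟩
  · exact ⟨fun _ _ => 0, fun _ => continuous_const, fun _ => HasCompactSupport.zero,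
      fun _ x => isEmptyElim x, fun _ x => isEmptyElim x, fun x => isEmptyElim x⟩
  refine ⟨fun n x => max 0 (min 1 (n + 1 - dist x z)), fun n => by fun_prop, fun n => ?_,
    fun n x => le_max_left _ _, fun n x => max_le zero_le_one (min_le_left _ _), fun x => ?_⟩
  · refine HasCompactSupport.intro (isCompact_closedBall z (n + 1)) fun x hx => ?_
    rw [Metric.mem_closedBall, not_le] at hx
    exact max_eq_left ((min_le_right _ _).trans (by linarith))
  · refine tendsto_const_nhds.congr' ?_
    filter_upwards [eventually_ge_atTop ⌈dist x z⌉₊] with n hn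
    have h : dist x z ≤ n := Nat.ceil_le.mp hn
    rw [min_eq_left (by linarith), max_eq_right zero_le_one]

end Cutoff

section Majorants

variable {X Y : Type*} [TopologicalSpace X] [MeasurableSpace X] [TopologicalSpace Y]
  [MeasurableSpace Y]

/-- The dual values `∫ f ∂P + ∫ g ∂Q` over integrable continuous `f`, `g` such that `f ⊕ g`
dominates `h`. -/
def majorantValues (P : Measure X) (Q : Measure Y) (h : X × Y → ℝ) : Set ℝ :=
  {r | ∃ f g, Continuous f ∧ Continuous g ∧ Integrable f P ∧ Integrable g Q ∧
    (∀ x y, h (x, y) ≤ f x + g y) ∧ r = (∫ x, f x ∂P) + ∫ y, g y ∂Q}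

variable {P : Measure X} {Q : Measure Y}

lemma add_mem_majorantValues {h k : X × Y → ℝ} {r s : ℝ} (hr : r ∈ majorantValues P Q h)
    (hs : s ∈ majorantValues P Q k) : r + s ∈ majorantValues P Q (h + k) := by
  obtain ⟨f, g, hf, hg, hfi, hgi, hle, rfl⟩ := hr
  obtain ⟨f', g', hf', hg', hfi', hgi', hle', rfl⟩ := hs
  refine ⟨f + f', g + g', hf.add hf', hg.add hg', hfi.add hfi', hgi.add hgi', fun x y => ?_, ?_⟩
  · have := hle x y
    have := hle' x y
    simp only [Pi.add_apply]
    linarith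
  · simp only [Pi.add_apply]
    rw [integral_add hfi hfi', integral_add hgi hgi']
    ring

lemma smul_mem_majorantValues {h : X × Y → ℝ} {r c : ℝ} (hc : 0 ≤ c)
    (hr : r ∈ majorantValues P Q h) : c * r ∈ majorantValues P Q (c • h) := by
  obtain ⟨f, g, hf, hg, hfi, hgi, hle, rfl⟩ := hr
  refine ⟨fun x => c * f x, fun y => c * g y, by fun_prop, by fun_prop, hfi.const_mul c,
    hgi.const_mul c, fun x y => ?_, ?_⟩
  · have := mul_le_mul_of_nonneg_left (hle x y) hc
    simpa [mul_add] using this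
  · rw [integral_const_mul, integral_const_mul]
    ring

lemma zero_mem_majorantValues {h : X × Y → ℝ} (hh : h ≤ 0) : 0 ∈ majorantValues P Q h :=
  ⟨0, 0, continuous_const, continuous_const, integrable_zero _ _ _, integrable_zero _ _ _,
    fun x y => by simpa using hh (x, y), by simp⟩

lemma const_mem_majorantValues [IsProbabilityMeasure P] [IsProbabilityMeasure Q]
    {h : X × Y → ℝ} {C : ℝ} (hh : ∀ p, h p ≤ C) : C ∈ majorantValues P Q h :=
  ⟨fun _ => C, 0, continuous_const, continuous_const, integrable_const _, integrable_zero _ _ _,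
    fun x y => by simpa using hh (x, y), by simp⟩

lemma nonneg_of_mem_majorantValues_zero [IsProbabilityMeasure P] [IsProbabilityMeasure Q] {r : ℝ}
    (hr : r ∈ majorantValues P Q 0) : 0 ≤ r := by
  obtain ⟨f, g, hf, hg, hfi, hgi, hle, rfl⟩ := hr
  have hf' : Integrable (fun p : X × Y => f p.1) (P.prod Q) := hfi.comp_fst Q
  have hg' : Integrable (fun p : X × Y => g p.2) (P.prod Q) := hgi.comp_snd P
  have h : 0 ≤ ∫ p, (f p.1 + g p.2) ∂(P.prod Q) := integral_nonneg fun p => hle p.1 p.2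
  rw [integral_add hf' hg', integral_fun_fst, integral_fun_snd] at h
  simpa using h

lemma neg_le_of_mem_majorantValues [IsProbabilityMeasure P] [IsProbabilityMeasure Q]
    {h : X × Y → ℝ} {r s : ℝ} (hr : r ∈ majorantValues P Q h)
    (hs : s ∈ majorantValues P Q (-h)) : -s ≤ r := by
  have h := add_mem_majorantValues hr hs
  rw [add_neg_cancel] at h
  have := nonneg_of_mem_majorantValues_zero h
  linarith

variable (P Q) in
/-- The functions on `X × Y` bounded in absolute value by some `f ⊕ g` with `f`, `g` continuous and
integrable. -/
def majorized : Submodule ℝ (X × Y → ℝ) where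
  carrier := {h | (majorantValues P Q h).Nonempty ∧ (majorantValues P Q (-h)).Nonempty}
  zero_mem' := ⟨⟨0, zero_mem_majorantValues le_rfl⟩, ⟨0, zero_mem_majorantValues (by simp)⟩⟩
  add_mem' := by
    rintro h k ⟨⟨r, hr⟩, ⟨r', hr'⟩⟩ ⟨⟨s, hs⟩, ⟨s', hs'⟩⟩
    refine ⟨⟨_, add_mem_majorantValues hr hs⟩, ⟨r' + s', ?_⟩⟩
    rw [neg_add]
    exact add_mem_majorantValues hr' hs'
  smul_mem' := by
    rintro c h ⟨⟨r, hr⟩, ⟨s, hs⟩⟩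
    rcases le_total 0 c with hc | hc
    · refine ⟨⟨_, smul_mem_majorantValues hc hr⟩, ⟨c * s, ?_⟩⟩
      rw [← smul_neg]
      exact smul_mem_majorantValues hc hs
    · have hc' : 0 ≤ -c := neg_nonneg.mpr hc
      refine ⟨⟨-c * s, ?_⟩, ⟨-c * r, ?_⟩⟩
      · rw [← neg_smul_neg]
        exact smul_mem_majorantValues hc' hs
      · rw [← neg_smul]
        exact smul_mem_majorantValues hc' hr

lemma mem_majorized_of_abs_le [IsProbabilityMeasure P] [IsProbabilityMeasure Q] {h : X × Y → ℝ}
    {C : ℝ} (hh : ∀ p, |h p| ≤ C) : h ∈ majorized P Q :=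
  ⟨⟨C, const_mem_majorantValues fun p => (abs_le.mp (hh p)).2⟩,
    ⟨C, const_mem_majorantValues fun p => by
      have := (abs_le.mp (hh p)).1
      simp only [Pi.neg_apply]
      linarith⟩⟩

lemma sInf_majorantValues_le [IsProbabilityMeasure P] [IsProbabilityMeasure Q]
    (h : majorized P Q) {r : ℝ} (hr : r ∈ majorantValues P Q h) :
    sInf (majorantValues P Q h) ≤ r := by
  obtain ⟨s, hs⟩ := h.2.2
  exact csInf_le ⟨-s, fun t ht => neg_le_of_mem_majorantValues ht hs⟩ hr

/-- Hahn-Banach for the sublinear functional `h ↦ sInf (majorantValues P Q h)`. -/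
lemma exists_linear_eq_sInf_majorantValues [IsProbabilityMeasure P] [IsProbabilityMeasure Q]
    (h₀ : majorized P Q) :
    ∃ L : majorized P Q →ₗ[ℝ] ℝ, (∀ h : majorized P Q, ∀ r ∈ majorantValues P Q h, L h ≤ r) ∧
      L h₀ = sInf (majorantValues P Q h₀) := by
  set N : majorized P Q → ℝ := fun h => sInf (majorantValues P Q h)
  have hNle : ∀ (h : majorized P Q) (r : ℝ), r ∈ majorantValues P Q h → N h ≤ r :=
    fun h r hr => sInf_majorantValues_le h hr
  have hsmul_le : ∀ (c : ℝ), 0 < c → ∀ h, N (c • h) ≤ c * N h := by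
    intro c hc h
    rw [← div_le_iff₀' hc]
    refine le_csInf h.2.1 fun r hr => ?_
    rw [div_le_iff₀' hc]
    exact hNle _ _ (smul_mem_majorantValues hc.le hr)
  have hsmul : ∀ (c : ℝ), 0 < c → ∀ h, N (c • h) = c * N h := by
    intro c hc h
    refine le_antisymm (hsmul_le c hc h) ?_
    have := hsmul_le c⁻¹ (inv_pos.mpr hc) (c • h)
    rw [smul_smul, inv_mul_cancel₀ hc.ne', one_smul] at this
    rwa [← le_inv_mul_iff₀ hc]
  have hadd : ∀ h k, N (h + k) ≤ N h + N k := by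
    intro h k
    rw [← sub_le_iff_le_add]
    refine le_csInf h.2.1 fun r hr => ?_
    rw [sub_le_iff_le_add', ← sub_le_iff_le_add]
    refine le_csInf k.2.1 fun s hs => ?_
    rw [sub_le_iff_le_add']
    exact hNle _ _ (add_mem_majorantValues hr hs)
  have hzero : N 0 = 0 :=
    le_antisymm (hNle 0 0 (zero_mem_majorantValues le_rfl))
      (le_csInf (0 : majorized P Q).2.1 fun r hr => nonneg_of_mem_majorantValues_zero hr)
  have hlin : ∀ c : ℝ, c * N h₀ ≤ N (c • h₀) := by
    intro c
    rcases lt_trichotomy c 0 with hc | rfl | hc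
    · have h1 := hadd (c • h₀) ((-c) • h₀)
      rw [← add_smul, add_neg_cancel, zero_smul, hzero, hsmul (-c) (by linarith)] at h1
      linarith
    · simp [hzero]
    · exact (hsmul c hc h₀).ge
  obtain ⟨L, hL, hLN⟩ := exists_extension_of_le_sublinear
    (LinearPMap.mkSpanSingleton' (σ := RingHom.id ℝ) h₀ (N h₀) (by
      intro c hc
      rcases smul_eq_zero.mp hc with rfl | h
      · simp
      · rw [h, hzero, smul_zero])) N hsmul hadd (by
      rintro ⟨x, hx⟩
      obtain ⟨c, rfl⟩ := Submodule.mem_span_singleton.mp hx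
      rw [LinearPMap.mkSpanSingleton'_apply]
      simpa using hlin c)
  refine ⟨L, fun h r hr => (hLN h).trans (hNle h r hr), ?_⟩
  have := hL ⟨h₀, Submodule.mem_span_singleton_self h₀⟩
  exact this.trans (LinearPMap.mkSpanSingleton'_apply_self ..)

lemma integrable_coupling [BorelSpace X] [BorelSpace Y] [SecondCountableTopology X]
    {c : X × Y → ℝ} (hc : Continuous c) (hc0 : ∀ p, 0 ≤ c p) {u : X → ℝ}
    {v : Y → ℝ} (hui : Integrable u P) (hvi : Integrable v Q) (hcuv : ∀ x y, c (x, y) ≤ u x + v y)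
    {π : Measure (X × Y)} (hP : π.map Prod.fst = P) (hQ : π.map Prod.snd = Q) :
    Integrable c π := by
  rw [← hP] at hui
  rw [← hQ] at hvi
  refine ((hui.comp_measurable measurable_fst).add (hvi.comp_measurable measurable_snd)).mono'
    hc.aestronglyMeasurable (ae_of_all _ fun p => ?_)
  rw [Real.norm_of_nonneg (hc0 p)]
  exact hcuv p.1 p.2

end Majorants

section Truncation

variable {X Y : Type*} [TopologicalSpace X] [TopologicalSpace Y]

/-- The truncation of a continuous function at height `n`. -/
def truncBCF (f : X → ℝ) (hf : Continuous f) (n : ℕ) : X →ᵇ ℝ :=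
  BoundedContinuousFunction.ofNormedAddCommGroup (fun x => max (-n) (min n (f x))) (by fun_prop) n
    fun x => abs_le.mpr ⟨le_max_left _ _,
      max_le (by linarith [n.cast_nonneg (α := ℝ)]) (min_le_left _ _)⟩

lemma tendsto_integral_truncBCF [MeasurableSpace X] [BorelSpace X] {P : Measure X} {f : X → ℝ}
    (hf : Continuous f) (hfi : Integrable f P) :
    Tendsto (fun n => ∫ x, truncBCF f hf n x ∂P) atTop (𝓝 (∫ x, f x ∂P)) := by
  refine tendsto_integral_of_dominated_convergence (fun x => ‖f x‖)
    (fun n => (truncBCF f hf n).continuous.aestronglyMeasurable) hfi.norm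
    (fun n => ae_of_all _ fun x => ?_) (ae_of_all _ fun x => ?_)
  · change |max (-(n : ℝ)) (min n (f x))| ≤ |f x|
    have hn := n.cast_nonneg (α := ℝ)
    exact abs_le.mpr ⟨le_max_of_le_right (le_min (by linarith [abs_nonneg (f x)]) (neg_abs_le _)),
      max_le (by linarith [abs_nonneg (f x)]) ((min_le_right _ _).trans (le_abs_self _))⟩
  · refine tendsto_const_nhds.congr' ?_
    filter_upwards [eventually_ge_atTop ⌈|f x|⌉₊] with n hn
    have h := abs_le.mp (Nat.ceil_le.mp hn)
    change f x = max (-(n : ℝ)) (min n (f x))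
    rw [min_eq_right h.2, max_eq_right h.1]

lemma truncBCF_add_le {f : X → ℝ} {g : Y → ℝ} (hf : Continuous f) (hg : Continuous g) (n : ℕ)
    {x : X} {y : Y} {t : ℝ} (ht : 0 ≤ t) (h : f x + g y ≤ t) :
    truncBCF f hf n x + truncBCF g hg n y ≤ t := by
  change max (-(n : ℝ)) (min n (f x)) + max (-(n : ℝ)) (min n (g y)) ≤ t
  have hn := n.cast_nonneg (α := ℝ)
  rcases max_cases (-(n : ℝ)) (min n (f x)) with h1 | h1 <;>
  rcases max_cases (-(n : ℝ)) (min n (g y)) with h2 | h2 <;>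
  linarith [min_le_left (n : ℝ) (f x), min_le_right (n : ℝ) (f x), min_le_left (n : ℝ) (g y),
    min_le_right (n : ℝ) (g y)]

end Truncation

section Duality

variable {X Y : Type*} [MetricSpace X] [ProperSpace X] [MeasurableSpace X] [BorelSpace X]
  [MetricSpace Y] [ProperSpace Y] [MeasurableSpace Y] [BorelSpace Y]
  {P : Measure X} {Q : Measure Y}

/-- A linear functional dominated by the dual values is above integration against a coupling, on
nonnegative continuous functions. -/
lemma exists_coupling_integral_le [IsProbabilityMeasure P] [IsProbabilityMeasure Q]
    (L : majorized P Q →ₗ[ℝ] ℝ)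
    (hL : ∀ h : majorized P Q, ∀ r ∈ majorantValues P Q h, L h ≤ r) :
    ∃ π : Measure (X × Y), π.map Prod.fst = P ∧ π.map Prod.snd = Q ∧
      ∀ c : majorized P Q, Continuous (c : X × Y → ℝ) → (∀ p, 0 ≤ (c : X × Y → ℝ) p) →
        ∫ p, (c : X × Y → ℝ) p ∂π ≤ L c := by
  have hmem : ∀ f : C_c(X × Y, ℝ), (f : X × Y → ℝ) ∈ majorized P Q := fun f => by
    obtain ⟨C, hC⟩ := f.hasCompactSupport.exists_bound_of_continuous f.continuous
    exact mem_majorized_of_abs_le hC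
  have hmono : ∀ h k : majorized P Q, (h : X × Y → ℝ) ≤ k → L h ≤ L k := by
    intro h k hhk
    have := hL (h - k) 0 (zero_mem_majorantValues (by simpa using hhk))
    rw [map_sub] at this
    linarith
  let Λ : C_c(X × Y, ℝ) →ₚ[ℝ] ℝ := PositiveLinearMap.mk₀
    { toFun := fun f => L ⟨f, hmem f⟩
      map_add' := fun f g => by rw [← map_add]; rfl
      map_smul' := fun c f => by rw [RingHom.id_apply, ← map_smul]; rfl }
    (fun f hf => by
      have := hmono 0 ⟨f, hmem f⟩ (fun p => hf p)
      rwa [map_zero] at this)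
  have hΛ : ∀ f, Λ f = L ⟨f, hmem f⟩ := fun f => rfl
  set π := RealRMK.rieszMeasure Λ
  have hπint : ∀ f : C_c(X × Y, ℝ), ∫ p, f p ∂π = L ⟨f, hmem f⟩ := fun f =>
    RealRMK.integral_rieszMeasure Λ f
  have hπfin : IsFiniteMeasure π := by
    refine ⟨lt_of_le_of_lt ?_ ENNReal.one_lt_top⟩
    rw [isOpen_univ.measure_eq_iSup_isCompact]
    refine iSup₂_le fun K _ => iSup_le fun hK => ?_
    obtain ⟨f, hf1, -, hfc, hf01⟩ :=
      exists_continuous_one_zero_of_isCompact hK isClosed_empty (Set.disjoint_empty K)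
    refine (RealRMK.rieszMeasure_le_of_eq_one Λ (f := ⟨f, hfc⟩) (fun x => (hf01 x).1) hK
      (fun x hx => hf1 hx)).trans ?_
    rw [ENNReal.ofReal_le_one, hΛ]
    exact hL _ 1 (const_mem_majorantValues fun p => (hf01 p).2)
  obtain ⟨a, ha, hac, ha0, ha1, hat⟩ := exists_cutoff_seq X
  obtain ⟨b, hb, hbc, hb0, hb1, hbt⟩ := exists_cutoff_seq Y
  have hk0 : ∀ n (p : X × Y), 0 ≤ a n p.1 * b n p.2 := fun n p => mul_nonneg (ha0 _ _) (hb0 _ _)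
  have hk1 : ∀ n (p : X × Y), a n p.1 * b n p.2 ≤ 1 := fun n p =>
    mul_le_one₀ (ha1 _ _) (hb0 _ _) (hb1 _ _)
  have hkt : ∀ p : X × Y, Tendsto (fun n => a n p.1 * b n p.2) atTop (𝓝 1) := fun p => by
    simpa using (hat p.1).mul (hbt p.2)
  have hkc : ∀ (h : X × Y → ℝ) (n : ℕ),
      HasCompactSupport fun p : X × Y => h p * (a n p.1 * b n p.2) := by
    intro h n
    refine HasCompactSupport.intro ((hac n).isCompact.prod (hbc n).isCompact) fun p hp => ?_
    rw [Set.mem_prod, not_and_or] at hp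
    rcases hp with hp | hp <;> simp [image_eq_zero_of_notMem_tsupport hp]
  let cut (h : X × Y → ℝ) (hh : Continuous h) (n : ℕ) : C_c(X × Y, ℝ) :=
    ⟨⟨fun p => h p * (a n p.1 * b n p.2), by have := ha n; have := hb n; fun_prop⟩, hkc h n⟩
  have hlim : ∀ (h : X × Y → ℝ) (hh : Continuous h), Integrable h π →
      Tendsto (fun n => L ⟨cut h hh n, hmem _⟩) atTop (𝓝 (∫ p, h p ∂π)) := by
    intro h hh hi
    simp_rw [← hπint]
    refine tendsto_integral_of_dominated_convergence (fun p => ‖h p‖)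
      (fun n => (cut h hh n).continuous.aestronglyMeasurable) hi.norm
      (fun n => ae_of_all _ fun p => ?_) (ae_of_all _ fun p => ?_)
    · change ‖h p * (a n p.1 * b n p.2)‖ ≤ ‖h p‖
      rw [norm_mul, Real.norm_of_nonneg (hk0 n p)]
      exact mul_le_of_le_one_right (norm_nonneg _) (hk1 n p)
    · have := (hkt p).const_mul (h p)
      rwa [mul_one] at this
  have hmarg : ∀ (f : X →ᵇ ℝ) (g : Y →ᵇ ℝ),
      ∫ p, (f p.1 + g p.2) ∂π ≤ (∫ x, f x ∂P) + ∫ y, g y ∂Q := by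
    intro f g
    have hcont : Continuous fun p : X × Y => f p.1 + g p.2 := by fun_prop
    set C := ‖f‖ + ‖g‖
    have hC : 0 ≤ C := by positivity
    have hbd : ∀ p : X × Y, |f p.1 + g p.2| ≤ C := fun p =>
      (abs_add_le _ _).trans (add_le_add (f.norm_coe_le_norm _) (g.norm_coe_le_norm _))
    have hi : Integrable (fun p : X × Y => f p.1 + g p.2) π :=
      Integrable.of_bound hcont.aestronglyMeasurable C (ae_of_all _ hbd)
    have hfi : Integrable f P := f.integrable P
    have hgi : Integrable g Q := g.integrable Q
    have hai : ∀ n, Integrable (fun x => C * (1 - a n x)) P := fun n => by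
      refine Integrable.of_bound (C := C) (by have := ha n; fun_prop) (ae_of_all _ fun x => ?_)
      rw [Real.norm_of_nonneg (mul_nonneg hC (by linarith [ha1 n x]))]
      exact mul_le_of_le_one_right hC (by linarith [ha0 n x])
    have hbi : ∀ n, Integrable (fun x => C * (1 - b n x)) Q := fun n => by
      refine Integrable.of_bound (C := C) (by have := hb n; fun_prop) (ae_of_all _ fun x => ?_)
      rw [Real.norm_of_nonneg (mul_nonneg hC (by linarith [hb1 n x]))]
      exact mul_le_of_le_one_right hC (by linarith [hb0 n x])
    have hat' : Tendsto (fun n => ∫ x, (f x + C * (1 - a n x)) ∂P) atTop (𝓝 (∫ x, f x ∂P)) := by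
      refine tendsto_integral_of_dominated_convergence (fun x => ‖f x‖ + C)
        (fun n => (hfi.add (hai n)).1) (hfi.norm.add (integrable_const C))
        (fun n => ae_of_all _ fun x => (norm_add_le _ _).trans ?_) (ae_of_all _ fun x => ?_)
      · rw [Real.norm_of_nonneg (mul_nonneg hC (by linarith [ha1 n x]))]
        gcongr
        exact mul_le_of_le_one_right hC (by linarith [ha0 n x])
      · simpa using (((hat x).const_sub 1).const_mul C).const_add (f x)
    have hbt' : Tendsto (fun n => ∫ x, (g x + C * (1 - b n x)) ∂Q) atTop (𝓝 (∫ x, g x ∂Q)) := by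
      refine tendsto_integral_of_dominated_convergence (fun x => ‖g x‖ + C)
        (fun n => (hgi.add (hbi n)).1) (hgi.norm.add (integrable_const C))
        (fun n => ae_of_all _ fun x => (norm_add_le _ _).trans ?_) (ae_of_all _ fun x => ?_)
      · rw [Real.norm_of_nonneg (mul_nonneg hC (by linarith [hb1 n x]))]
        gcongr
        exact mul_le_of_le_one_right hC (by linarith [hb0 n x])
      · simpa using (((hbt x).const_sub 1).const_mul C).const_add (g x)
    refine le_of_tendsto_of_tendsto' (hlim _ hcont hi) (hat'.add hbt') fun n => hL _ _ ?_
    refine ⟨_, _, by have := ha n; fun_prop, by have := hb n; fun_prop, hfi.add (hai n),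
      hgi.add (hbi n), fun x y => ?_, rfl⟩
    change (f x + g y) * (a n x * b n y) ≤ f x + C * (1 - a n x) + (g y + C * (1 - b n y))
    have h1 : -(f x + g y) * (1 - a n x * b n y) ≤ C * (1 - a n x * b n y) :=
      mul_le_mul_of_nonneg_right (by linarith [(abs_le.mp (hbd (x, y))).1])
        (by linarith [hk1 n (x, y)])
    have h2 : C * (1 - a n x * b n y) ≤ C * ((1 - a n x) + (1 - b n y)) :=
      mul_le_mul_of_nonneg_left
        (by nlinarith [mul_nonneg (sub_nonneg.mpr (ha1 n x)) (sub_nonneg.mpr (hb1 n y))]) hC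
    linarith
  have hfst : π.map Prod.fst = P := by
    refine ext_of_forall_integral_eq_of_IsFiniteMeasure fun f => ?_
    rw [integral_map (by fun_prop) (by fun_prop)]
    refine le_antisymm ?_ ?_
    · simpa using hmarg f 0
    · have := hmarg (-f) 0
      simp only [BoundedContinuousFunction.coe_neg, Pi.neg_apply,
        BoundedContinuousFunction.coe_zero, Pi.zero_apply, add_zero, integral_neg,
        integral_zero] at this
      linarith
  have hsnd : π.map Prod.snd = Q := by
    refine ext_of_forall_integral_eq_of_IsFiniteMeasure fun g => ?_
    rw [integral_map (by fun_prop) (by fun_prop)]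
    refine le_antisymm ?_ ?_
    · simpa using hmarg 0 g
    · have := hmarg 0 (-g)
      simp only [BoundedContinuousFunction.coe_neg, Pi.neg_apply,
        BoundedContinuousFunction.coe_zero, Pi.zero_apply, zero_add, integral_neg,
        integral_zero] at this
      linarith
  refine ⟨π, hfst, hsnd, fun c hc hc0 => ?_⟩
  obtain ⟨-, f, g, hf, hg, hfi, hgi, hle, -⟩ := c.2.1
  have hi := integrable_coupling hc hc0 hfi hgi hle hfst hsnd
  exact le_of_tendsto' (hlim _ hc hi) fun n =>
    hmono _ _ fun p => mul_le_of_le_one_right (hc0 p) (hk1 n p)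

/-- An inequality between continuous functions holding almost everywhere for the product of the
marginals holds almost everywhere for the coupling. -/
lemma ae_of_ae_prod_marginals [IsProbabilityMeasure P] [IsProbabilityMeasure Q]
    {π : Measure (X × Y)} (hP : π.map Prod.fst = P) (hQ : π.map Prod.snd = Q) {F : Set (X × Y)}
    (hF : IsClosed F) (h : ∀ᵐ p ∂(P.prod Q), p ∈ F) : ∀ᵐ p ∂π, p ∈ F := by
  have h1 : ∀ᵐ p ∂π, p.1 ∈ P.support := by
    have : ∀ᵐ x ∂(π.map Prod.fst), x ∈ P.support := by
      rw [hP]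
      exact Measure.support_mem_ae_of_innerRegular
    exact ae_of_ae_map measurable_fst.aemeasurable this
  have h2 : ∀ᵐ p ∂π, p.2 ∈ Q.support := by
    have : ∀ᵐ x ∂(π.map Prod.snd), x ∈ Q.support := by
      rw [hQ]
      exact Measure.support_mem_ae_of_innerRegular
    exact ae_of_ae_map measurable_snd.aemeasurable this
  filter_upwards [h1, h2] with p hp1 hp2
  by_contra hp
  obtain ⟨U, hU, V, hV, hUV⟩ := mem_nhds_prod_iff.mp (hF.isOpen_compl.mem_nhds hp)
  have h0 : (P.prod Q) (U ×ˢ V) = 0 := measure_mono_null hUV h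
  rw [Measure.prod_prod, mul_eq_zero] at h0
  rcases h0 with h0 | h0
  · exact ((Measure.mem_support_iff_forall _).mp hp1 U hU).ne' h0
  · exact ((Measure.mem_support_iff_forall _).mp hp2 V hV).ne' h0

/-- The easy inequality of Kantorovich duality. -/
lemma integral_add_integral_le_of_coupling [IsProbabilityMeasure P] [IsProbabilityMeasure Q]
    {c : X × Y → ℝ} (hc : Continuous c) (hc0 : ∀ p, 0 ≤ c p) {u : X → ℝ} {v : Y → ℝ}
    (hui : Integrable u P) (hvi : Integrable v Q) (hcuv : ∀ x y, c (x, y) ≤ u x + v y)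
    {π : Measure (X × Y)} (hP : π.map Prod.fst = P) (hQ : π.map Prod.snd = Q)
    {φ : X →ᵇ ℝ} {ψ : Y →ᵇ ℝ} (h : ∀ᵐ p ∂(P.prod Q), φ p.1 + ψ p.2 ≤ c p) :
    (∫ x, φ x ∂P) + ∫ y, ψ y ∂Q ≤ ∫ p, c p ∂π := by
  have hci := integrable_coupling hc hc0 hui hvi hcuv hP hQ
  have hφ : Integrable (fun p : X × Y => φ p.1) π := by
    have h := φ.integrable P
    rw [← hP] at h
    exact h.comp_measurable measurable_fst
  have hψ : Integrable (fun p : X × Y => ψ p.2) π := by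
    have h := ψ.integrable Q
    rw [← hQ] at h
    exact h.comp_measurable measurable_snd
  calc (∫ x, φ x ∂P) + ∫ y, ψ y ∂Q = (∫ p, φ p.1 ∂π) + ∫ p, ψ p.2 ∂π := by
        congr 1
        · conv_lhs => rw [← hP]
          exact integral_map (by fun_prop) (by fun_prop)
        · conv_lhs => rw [← hQ]
          exact integral_map (by fun_prop) (by fun_prop)
    _ = ∫ p, (φ p.1 + ψ p.2) ∂π := (integral_add hφ hψ).symm
    _ ≤ ∫ p, c p ∂π := integral_mono_ae (hφ.add hψ) hci
        (ae_of_ae_prod_marginals hP hQ (isClosed_le (by fun_prop) hc) h)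

/-- **Kantorovich duality** for a nonnegative continuous cost dominated by an integrable `u ⊕ v`:
some coupling attains the supremum of the dual problem. -/
theorem exists_coupling_isLUB_dual [IsProbabilityMeasure P] [IsProbabilityMeasure Q]
    {c : X × Y → ℝ} (hc : Continuous c) (hc0 : ∀ p, 0 ≤ c p) {u : X → ℝ} {v : Y → ℝ}
    (hu : Continuous u) (hv : Continuous v) (hui : Integrable u P) (hvi : Integrable v Q)
    (hcuv : ∀ x y, c (x, y) ≤ u x + v y) :
    ∃ π : Measure (X × Y), π.map Prod.fst = P ∧ π.map Prod.snd = Q ∧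
      IsLUB {r : ℝ | ∃ (φ : X →ᵇ ℝ) (ψ : Y →ᵇ ℝ), (∀ᵐ p ∂(P.prod Q), φ p.1 + ψ p.2 ≤ c p) ∧
        r = (∫ x, φ x ∂P) + ∫ y, ψ y ∂Q} (∫ p, c p ∂π) := by
  have hcm : c ∈ majorized P Q :=
    ⟨⟨_, u, v, hu, hv, hui, hvi, hcuv, rfl⟩,
      ⟨0, zero_mem_majorantValues fun p => neg_nonpos.mpr (hc0 p)⟩⟩
  obtain ⟨L, hL, hLc⟩ := exists_linear_eq_sInf_majorantValues (-⟨c, hcm⟩ : majorized P Q)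
  obtain ⟨π, hP, hQ, hπ⟩ := exists_coupling_integral_le L hL
  refine ⟨π, hP, hQ, ?_, fun B hB => ?_⟩
  · rintro _ ⟨φ, ψ, h, rfl⟩
    exact integral_add_integral_le_of_coupling hc hc0 hui hvi hcuv hP hQ h
  refine (hπ ⟨c, hcm⟩ hc hc0).trans ?_
  rw [map_neg] at hLc
  suffices h : -B ≤ sInf (majorantValues P Q (-⟨c, hcm⟩ : majorized P Q)) by linarith
  refine le_csInf (-⟨c, hcm⟩ : majorized P Q).2.1 ?_
  rintro _ ⟨f, g, hf, hg, hfi, hgi, hle, rfl⟩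
  have hlim := (tendsto_integral_truncBCF hf.neg hfi.neg).add
    (tendsto_integral_truncBCF hg.neg hgi.neg)
  have h := le_of_tendsto' hlim fun n => hB ⟨truncBCF _ hf.neg n, truncBCF _ hg.neg n,
    ae_of_all _ fun p => truncBCF_add_le hf.neg hg.neg n (hc0 p) (by
      have : -c p ≤ f p.1 + g p.2 := hle p.1 p.2
      simp only [Pi.neg_apply]
      linarith), rfl⟩
  simp only [Pi.neg_apply, integral_neg] at h
  linarith

end Duality

section Normalization

variable {x₀ : Euc d} {a : ℝ} {μ : Measure (Euc d)}

lemma continuous_dil : Continuous (dil x₀ a) := by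
  unfold dil
  fun_prop

lemma dil_inv_dil (ha : a ≠ 0) (x : Euc d) : dil x₀ a⁻¹ (dil x₀ a x) = x := by
  simp [dil, smul_smul, ha]

lemma dil_dil_inv (ha : a ≠ 0) (x : Euc d) : dil x₀ a (dil x₀ a⁻¹ x) = x := by
  simp [dil, smul_smul, ha]

lemma integrable_norm_sq_dil [IsFiniteMeasure μ] (h : Integrable (fun x => ‖x‖ ^ 2) μ) :
    Integrable (fun x => ‖dil x₀ a x‖ ^ 2) μ := by
  refine ((h.const_mul (2 * a ^ 2)).add (integrable_const (2 * ‖x₀ - a • x₀‖ ^ 2))).mono'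
    (by have := continuous_dil (x₀ := x₀) (a := a); fun_prop) (ae_of_all _ fun x => ?_)
  have hx : dil x₀ a x = a • x + (x₀ - a • x₀) := by
    rw [dil, smul_sub]
    abel
  have hn := norm_add_le (a • x) (x₀ - a • x₀)
  rw [← hx, norm_smul, Real.norm_eq_abs] at hn
  rw [Real.norm_of_nonneg (by positivity), ← sq_abs a]
  simp only [Pi.add_apply]
  nlinarith [sq_nonneg (|a| * ‖x‖ - ‖x₀ - a • x₀‖), norm_nonneg (dil x₀ a x)]

lemma nm_of_mass_pos (h : 0 < mass μ) : nm x₀ μ = (μ Set.univ)⁻¹ • μ :=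
  if_neg fun h0 => by simp [mass, h0] at h

lemma isProbabilityMeasure_nm [IsFiniteMeasure μ] (h : 0 < mass μ) :
    IsProbabilityMeasure (nm x₀ μ) := by
  rw [nm_of_mass_pos h]
  refine ⟨?_⟩
  rw [Measure.smul_apply, smul_eq_mul]
  exact ENNReal.inv_mul_cancel (fun h0 => by simp [mass, h0] at h) (measure_ne_top _ _)

lemma nm_absolutelyContinuous (h : 0 < mass μ) : nm x₀ μ ≪ μ := by
  rw [nm_of_mass_pos h]
  exact Measure.smul_absolutelyContinuous

lemma absolutelyContinuous_nm [IsFiniteMeasure μ] (h : 0 < mass μ) : μ ≪ nm x₀ μ := by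
  rw [nm_of_mass_pos h]
  exact Measure.absolutelyContinuous_smul (ENNReal.inv_ne_zero.mpr (measure_ne_top _ _))

lemma integral_nm (h : 0 < mass μ) (f : Euc d → ℝ) :
    mass μ * ∫ x, f x ∂(nm x₀ μ) = ∫ x, f x ∂μ := by
  rw [nm_of_mass_pos h, integral_smul_measure, ENNReal.toReal_inv, smul_eq_mul]
  exact mul_inv_cancel_left₀ h.ne' _

lemma integrable_nm (h : 0 < mass μ) {f : Euc d → ℝ} (hf : Integrable f μ) :
    Integrable f (nm x₀ μ) := by
  rw [nm_of_mass_pos h]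
  exact hf.smul_measure (ENNReal.inv_ne_top.mpr fun h0 => by simp [mass, h0] at h)

end Normalization

/-- dual formulation of `WOP`. -/
theorem WOP2_dual (d : ℕ) (x₀ : Euc d) (μ ν : Measure (Euc d))
    (hμ : MemM μ) (hν : MemM ν) (hmμ : 0 < mass μ) (hmν : 0 < mass ν) :
    WOP2 x₀ μ ν = sSup { r : ℝ | ∃ φ ψ : BoundedContinuousFunction (Euc d) ℝ,
      (∀ᵐ p : Euc d × Euc d ∂(μ.prod ν),
        mass μ * φ p.1 + mass ν * ψ p.2 ≤
          (mass μ - mass ν) ^ 2 + ‖dil x₀ (mass μ) p.1 - dil x₀ (mass ν) p.2‖ ^ 2) ∧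
      r = (∫ x, φ x ∂μ) + ∫ y, ψ y ∂ν } := by
  have : IsFiniteMeasure μ := hμ.1
  have : IsFiniteMeasure ν := hν.1
  set a := mass μ
  set b := mass ν
  set P := nm x₀ μ with hP
  set Q := nm x₀ ν with hQ
  have : IsProbabilityMeasure P := isProbabilityMeasure_nm hmμ
  have : IsProbabilityMeasure Q := isProbabilityMeasure_nm hmν
  have hTa : Continuous (dil x₀ a) := continuous_dil
  have hTb : Continuous (dil x₀ b) := continuous_dil
  have hSa : Continuous (dil x₀ a⁻¹) := continuous_dil
  have hSb : Continuous (dil x₀ b⁻¹) := continuous_dil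
  set c : Euc d × Euc d → ℝ := fun p => (a - b) ^ 2 + ‖dil x₀ a p.1 - dil x₀ b p.2‖ ^ 2 with hcdef
  have hc : Continuous c := by fun_prop
  have hc0 : ∀ p, 0 ≤ c p := fun p => by positivity
  have hui : Integrable (fun x => (a - b) ^ 2 + 2 * ‖dil x₀ a x‖ ^ 2) P :=
    (integrable_const _).add ((integrable_nm hmμ (integrable_norm_sq_dil hμ.2)).const_mul 2)
  have hvi : Integrable (fun y => 2 * ‖dil x₀ b y‖ ^ 2) Q :=
    (integrable_nm hmν (integrable_norm_sq_dil hν.2)).const_mul 2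
  have hcuv : ∀ x y, c (x, y) ≤ ((a - b) ^ 2 + 2 * ‖dil x₀ a x‖ ^ 2) + 2 * ‖dil x₀ b y‖ ^ 2 := by
    intro x y
    have := norm_sub_le (dil x₀ a x) (dil x₀ b y)
    simp only [hcdef]
    nlinarith [sq_nonneg (‖dil x₀ a x‖ - ‖dil x₀ b y‖), norm_nonneg (dil x₀ a x - dil x₀ b y)]
  have hcost : ∀ π : Measure (Euc d × Euc d), π.map Prod.fst = P → π.map Prod.snd = Q →
      ∫ p, c p ∂π = (a - b) ^ 2 + ∫ p, ‖dil x₀ a p.1 - dil x₀ b p.2‖ ^ 2 ∂π := by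
    intro π h1 h2
    have hπ : IsProbabilityMeasure π := by
      have : IsProbabilityMeasure (π.map Prod.fst) := h1 ▸ inferInstance
      exact Measure.isProbabilityMeasure_of_map Prod.fst
    have hi := (integrable_coupling hc hc0 hui hvi hcuv h1 h2).sub
      (integrable_const ((a - b) ^ 2))
    rw [integral_add (integrable_const _) (hi.congr (ae_of_all _ fun p => by simp [hcdef]))]
    simp
  have hset : {r : ℝ | ∃ φ ψ : BoundedContinuousFunction (Euc d) ℝ,
      (∀ᵐ p : Euc d × Euc d ∂(μ.prod ν), a * φ p.1 + b * ψ p.2 ≤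
        (a - b) ^ 2 + ‖dil x₀ a p.1 - dil x₀ b p.2‖ ^ 2) ∧
      r = (∫ x, φ x ∂μ) + ∫ y, ψ y ∂ν} =
      {r : ℝ | ∃ (φ : Euc d →ᵇ ℝ) (ψ : Euc d →ᵇ ℝ), (∀ᵐ p ∂(P.prod Q), φ p.1 + ψ p.2 ≤ c p) ∧
        r = (∫ x, φ x ∂P) + ∫ y, ψ y ∂Q} := by
    ext r
    constructor
    · rintro ⟨φ, ψ, h, rfl⟩
      refine ⟨a • φ, b • ψ,
        ((nm_absolutelyContinuous hmμ).prod (nm_absolutelyContinuous hmν)) h, ?_⟩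
      simp only [BoundedContinuousFunction.coe_smul, smul_eq_mul, integral_const_mul]
      rw [integral_nm hmμ, integral_nm hmν]
    · rintro ⟨φ, ψ, h, rfl⟩
      refine ⟨a⁻¹ • φ, b⁻¹ • ψ, ?_, ?_⟩
      · filter_upwards [((absolutelyContinuous_nm hmμ).prod (absolutelyContinuous_nm hmν)) h]
          with p hp
        simpa [mul_inv_cancel_left₀ hmμ.ne', mul_inv_cancel_left₀ hmν.ne'] using hp
      · simp only [BoundedContinuousFunction.coe_smul, smul_eq_mul, integral_const_mul]
        rw [← integral_nm (x₀ := x₀) hmμ, ← integral_nm (x₀ := x₀) hmν,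
          inv_mul_cancel_left₀ hmμ.ne', inv_mul_cancel_left₀ hmν.ne']
  obtain ⟨π, h1, h2, hlub⟩ := exists_coupling_isLUB_dual hc hc0 (by fun_prop) (by fun_prop)
    hui hvi hcuv
  rw [hset, hlub.csSup_eq ⟨0, 0, 0, ae_of_all _ fun p => by simpa using hc0 p, by simp⟩,
    hcost π h1 h2, WOP2]
  congr 1
  refine IsLeast.csInf_eq ⟨⟨π.map (Prod.map (dil x₀ a) (dil x₀ b)), ?_, ?_, ?_⟩, ?_⟩
  · rw [Measure.map_map (by fun_prop) (by fun_prop), Prod.map_fst', ← hP, ← h1,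
      Measure.map_map (by fun_prop) (by fun_prop)]
  · rw [Measure.map_map (by fun_prop) (by fun_prop), Prod.map_snd', ← hQ, ← h2,
      Measure.map_map (by fun_prop) (by fun_prop)]
  · rw [integral_map (by fun_prop) (by fun_prop)]
    rfl
  rintro _ ⟨ρ, hρ1, hρ2, rfl⟩
  set σ := ρ.map (Prod.map (dil x₀ a⁻¹) (dil x₀ b⁻¹)) with hσ
  have hσ1 : σ.map Prod.fst = P := by
    rw [Measure.map_map (by fun_prop) (by fun_prop), Prod.map_fst',
      ← Measure.map_map (by fun_prop) (by fun_prop), hρ1,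
      Measure.map_map (by fun_prop) (by fun_prop)]
    exact (congrArg (P.map ·) (funext (dil_inv_dil hmμ.ne'))).trans Measure.map_id
  have hσ2 : σ.map Prod.snd = Q := by
    rw [Measure.map_map (by fun_prop) (by fun_prop), Prod.map_snd',
      ← Measure.map_map (by fun_prop) (by fun_prop), hρ2,
      Measure.map_map (by fun_prop) (by fun_prop)]
    exact (congrArg (Q.map ·) (funext (dil_inv_dil hmν.ne'))).trans Measure.map_id
  have hle : ∫ p, c p ∂π ≤ ∫ p, c p ∂σ := hlub.2 fun _ ⟨φ, ψ, h, hr⟩ =>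
    hr ▸ integral_add_integral_le_of_coupling hc hc0 hui hvi hcuv hσ1 hσ2 h
  rw [hcost π h1 h2, hcost σ hσ1 hσ2, hσ, integral_map (by fun_prop) (by fun_prop)] at hle
  simpa [dil_dil_inv hmμ.ne', dil_dil_inv hmν.ne'] using hle

end
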